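/- arXiv:hep-th/9903056 — 2 statements merged into one kernel-verified Lean document; each statement's English description precedes it below -/
import Mathlib

section
/- Let A be the adjacency matrix of a finite connected undirected graph. Then the graph's largest eigenvalue is at most 2 if and only if the graph is one of the (extended) ADE Dynkin diagrams A_n, D_n, E_6, E_7, E_8 or their affine versions; equivalently, the largest eigenvalue equals 2 exactly for the affine diagrams Â_n, D̂_n, Ê_6, Ê_7, Ê_8. -/
open SimpleGraph

/-- Adjacency matrix over `ℝ` (with classical decidability of adjacency). -/
noncomputable def adjMat {V : Type} [Fintype V] [DecidableEq V] (G : SimpleGraph V) :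
    Matrix V V ℝ :=
  letI := Classical.decRel G.Adj
  G.adjMatrix ℝ

/-- `μ` is an eigenvalue of the adjacency matrix of `G`. -/
def IsAdjEigenvalue {V : Type} [Fintype V] [DecidableEq V] (G : SimpleGraph V)
    (μ : ℝ) : Prop :=
  ∃ v : V → ℝ, v ≠ 0 ∧ (adjMat G).mulVec v = μ • v

/-- The Dynkin diagram `D_n` on `n` nodes: a chain `0 — 1 — ⋯ — (n-2)` together with an
extra node `n-1` attached to node `n-3`. -/
def typeD (n : ℕ) : SimpleGraph (Fin n) :=
  SimpleGraph.fromRel (fun i j =>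
    ((i : ℕ) + 1 = j ∧ (j : ℕ) ≤ n - 2) ∨ ((i : ℕ) = n - 3 ∧ (j : ℕ) = n - 1))

/-- The Dynkin diagram `E_m` (`m = 6,7,8`) on `m` nodes: a chain `0 — 1 — ⋯ — (m-2)`
together with an extra node `m-1` attached to node `2`. -/
def typeE (m : ℕ) : SimpleGraph (Fin m) :=
  SimpleGraph.fromRel (fun i j =>
    ((i : ℕ) + 1 = j ∧ (j : ℕ) ≤ m - 2) ∨ ((i : ℕ) = 2 ∧ (j : ℕ) = m - 1))

/-- The affine Dynkin diagram `D̂_n` on `n+1` nodes: `D_n` together with an extra node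
`n` attached to node `1`. -/
def typeDAffine (n : ℕ) : SimpleGraph (Fin (n + 1)) :=
  SimpleGraph.fromRel (fun i j =>
    ((i : ℕ) + 1 = j ∧ (j : ℕ) ≤ n - 2) ∨ ((i : ℕ) = n - 3 ∧ (j : ℕ) = n - 1) ∨
      ((i : ℕ) = 1 ∧ (j : ℕ) = n))

/-- The affine Dynkin diagram `Ê_6` on `7` nodes. -/
def typeE6Affine : SimpleGraph (Fin 7) :=
  SimpleGraph.fromRel (fun i j =>
    ((i : ℕ) + 1 = j ∧ (j : ℕ) ≤ 4) ∨ ((i : ℕ) = 2 ∧ (j : ℕ) = 5) ∨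
      ((i : ℕ) = 5 ∧ (j : ℕ) = 6))

/-- The affine Dynkin diagram `Ê_7` on `8` nodes. -/
def typeE7Affine : SimpleGraph (Fin 8) :=
  SimpleGraph.fromRel (fun i j =>
    ((i : ℕ) + 1 = j ∧ (j : ℕ) ≤ 5) ∨ ((i : ℕ) = 2 ∧ (j : ℕ) = 6) ∨
      ((i : ℕ) = 0 ∧ (j : ℕ) = 7))

/-- The affine Dynkin diagram `Ê_8` on `9` nodes. -/
def typeE8Affine : SimpleGraph (Fin 9) :=
  SimpleGraph.fromRel (fun i j =>
    ((i : ℕ) + 1 = j ∧ (j : ℕ) ≤ 6) ∨ ((i : ℕ) = 2 ∧ (j : ℕ) = 7) ∨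
      ((i : ℕ) = 6 ∧ (j : ℕ) = 8))

/-- `G` is isomorphic to one of the (finite) ADE Dynkin diagrams
`A_n, D_n, E_6, E_7, E_8`. -/
def IsADE {V : Type} (G : SimpleGraph V) : Prop :=
  (∃ n, 1 ≤ n ∧ Nonempty (G ≃g pathGraph n)) ∨
  (∃ n, 4 ≤ n ∧ Nonempty (G ≃g typeD n)) ∨
  Nonempty (G ≃g typeE 6) ∨ Nonempty (G ≃g typeE 7) ∨ Nonempty (G ≃g typeE 8)

/-- `G` is isomorphic to one of the affine ADE Dynkin diagrams
`Â_n (the (n+1)-cycle), D̂_n, Ê_6, Ê_7, Ê_8`. -/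
def IsAffineADE {V : Type} (G : SimpleGraph V) : Prop :=
  (∃ n, 2 ≤ n ∧ Nonempty (G ≃g cycleGraph (n + 1))) ∨
  (∃ n, 4 ≤ n ∧ Nonempty (G ≃g typeDAffine n)) ∨
  Nonempty (G ≃g typeE6Affine) ∨ Nonempty (G ≃g typeE7Affine) ∨
    Nonempty (G ≃g typeE8Affine)

/-! ### Spectral part -/

open Classical in
/-- Sum of `v` over the neighbours of `x`. -/
noncomputable def nbrSum {V : Type} [Fintype V] (G : SimpleGraph V) (v : V → ℝ) (x : V) : ℝ :=
  ∑ y, if G.Adj x y then v y else 0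

theorem adjMat_mulVec {V : Type} [Fintype V] [DecidableEq V] (G : SimpleGraph V)
    (v : V → ℝ) (x : V) : (adjMat G).mulVec v x = nbrSum G v x := by
  classical
  simp only [adjMat, nbrSum, Matrix.mulVec, dotProduct, SimpleGraph.adjMatrix_apply, ite_mul,
    one_mul, zero_mul]

theorem isAdjEigenvalue_iff {V : Type} [Fintype V] [DecidableEq V] (G : SimpleGraph V) (μ : ℝ) :
    IsAdjEigenvalue G μ ↔ ∃ v : V → ℝ, v ≠ 0 ∧ ∀ x, nbrSum G v x = μ * v x := by
  unfold IsAdjEigenvalue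
  simp only [funext_iff, adjMat_mulVec, Pi.smul_apply, smul_eq_mul]

theorem nbrSum_symm {V : Type} [Fintype V] (G : SimpleGraph V) (v w : V → ℝ) :
    ∑ x, v x * nbrSum G w x = ∑ x, nbrSum G v x * w x := by
  classical
  simp only [nbrSum, Finset.mul_sum, Finset.sum_mul]
  rw [Finset.sum_comm]
  refine Finset.sum_congr rfl fun x _ => Finset.sum_congr rfl fun y _ => ?_
  simp only [G.adj_comm x y]
  split_ifs <;> ring

theorem nbrSum_abs {V : Type} [Fintype V] (G : SimpleGraph V) (v : V → ℝ) (x : V) :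
    |nbrSum G v x| ≤ nbrSum G (fun y => |v y|) x := by
  classical
  unfold nbrSum
  refine (Finset.abs_sum_le_sum_abs _ _).trans (Finset.sum_le_sum fun y _ => ?_)
  split_ifs <;> simp

/-- Zeros of a nonnegative vector with `A w = 2 w` propagate. -/
theorem zero_propagates {V : Type} [Fintype V] (G : SimpleGraph V) (hG : G.Connected)
    (w : V → ℝ) (hw : ∀ x, 0 ≤ w x) (h : ∀ x, nbrSum G w x = 2 * w x) (x : V) (hx : w x = 0)
    (y : V) : w y = 0 := by
  classical
  have step : ∀ a b, G.Adj a b → w a = 0 → w b = 0 := by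
    intro a b hab ha
    have h1 := h a
    rw [ha, mul_zero, nbrSum, Finset.sum_eq_zero_iff_of_nonneg] at h1
    · have := h1 b (Finset.mem_univ _)
      simpa [hab] using this
    · intro c _
      split_ifs
      · exact hw c
      · exact le_rfl
  obtain ⟨p⟩ := hG.preconnected x y
  induction p with
  | nil => exact hx
  | cons hadj _ ih => exact ih (step _ _ hadj hx)

/-- A positive subinvariant vector bounds the eigenvalues by `2`. -/
theorem eig_le_two {V : Type} [Fintype V] [DecidableEq V] (G : SimpleGraph V)
    (v : V → ℝ) (hv : ∀ x, 0 < v x) (h : ∀ x, nbrSum G v x ≤ 2 * v x) (μ : ℝ)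
    (hμ : IsAdjEigenvalue G μ) : μ ≤ 2 := by
  obtain ⟨u, hu, hue⟩ := (isAdjEigenvalue_iff G μ).1 hμ
  have h1 : ∑ x, v x * (μ * |u x|) ≤ ∑ x, v x * nbrSum G (fun y => |u y|) x := by
    refine Finset.sum_le_sum fun x _ => mul_le_mul_of_nonneg_left ?_ (hv x).le
    refine le_trans ?_ (nbrSum_abs G u x)
    rw [hue, abs_mul]
    exact mul_le_mul_of_nonneg_right (le_abs_self _) (abs_nonneg _)
  have h2 : ∑ x, v x * nbrSum G (fun y => |u y|) x ≤ ∑ x, (2 * v x) * |u x| := by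
    rw [nbrSum_symm]
    exact Finset.sum_le_sum fun x _ => mul_le_mul_of_nonneg_right (h x) (abs_nonneg _)
  have h3 : 0 < ∑ x, v x * |u x| := by
    obtain ⟨x, hx⟩ := Function.ne_iff.1 hu
    refine Finset.sum_pos' (fun y _ => mul_nonneg (hv y).le (abs_nonneg _)) ⟨x, Finset.mem_univ _, ?_⟩
    exact mul_pos (hv x) (abs_pos.2 hx)
  have e1 : ∑ x, v x * (μ * |u x|) = μ * ∑ x, v x * |u x| := by
    rw [Finset.mul_sum]; exact Finset.sum_congr rfl fun x _ => by ring
  have e2 : ∑ x, (2 * v x) * |u x| = 2 * ∑ x, v x * |u x| := by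
    rw [Finset.mul_sum]; exact Finset.sum_congr rfl fun x _ => by ring
  rw [e1] at h1
  rw [e2] at h2
  exact le_of_mul_le_mul_right (h1.trans h2) h3

/-- A positive, somewhere strictly, subinvariant vector excludes the eigenvalue `2`. -/
theorem two_not_eig {V : Type} [Fintype V] [DecidableEq V] (G : SimpleGraph V) (hG : G.Connected)
    (v : V → ℝ) (hv : ∀ x, 0 < v x) (h : ∀ x, nbrSum G v x ≤ 2 * v x)
    (hs : ∃ x, nbrSum G v x < 2 * v x) : ¬ IsAdjEigenvalue G 2 := by
  intro hμ
  obtain ⟨u, hu, hue⟩ := (isAdjEigenvalue_iff G 2).1 hμ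
  have h0 : ∀ x, 0 ≤ v x * (nbrSum G (fun y => |u y|) x - 2 * |u x|) := by
    intro x
    refine mul_nonneg (hv x).le (sub_nonneg.2 ?_)
    refine le_trans ?_ (nbrSum_abs G u x)
    rw [hue, abs_mul, abs_two]
  have h0' : ∀ x, 0 ≤ (2 * v x - nbrSum G v x) * |u x| := fun x =>
    mul_nonneg (sub_nonneg.2 (h x)) (abs_nonneg _)
  have hsum : ∑ x, v x * (nbrSum G (fun y => |u y|) x - 2 * |u x|)
      + ∑ x, (2 * v x - nbrSum G v x) * |u x| = 0 := by
    have := nbrSum_symm G v (fun y => |u y|)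
    simp only [mul_sub, sub_mul, Finset.sum_sub_distrib]
    rw [this]
    have e : ∑ x, v x * (2 * |u x|) = ∑ x, 2 * v x * |u x| :=
      Finset.sum_congr rfl fun x _ => by ring
    rw [e]; ring
  have n1 := Finset.sum_nonneg fun x (_ : x ∈ Finset.univ) => h0 x
  have n2 := Finset.sum_nonneg fun x (_ : x ∈ Finset.univ) => h0' x
  have z1 := (Finset.sum_eq_zero_iff_of_nonneg fun x (_ : x ∈ Finset.univ) => h0 x).1 (by linarith)
  have z2 := (Finset.sum_eq_zero_iff_of_nonneg fun x (_ : x ∈ Finset.univ) => h0' x).1 (by linarith)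
  obtain ⟨x, hx⟩ := hs
  have hux : |u x| = 0 := by
    rcases mul_eq_zero.1 (z2 x (Finset.mem_univ _)) with h' | h'
    · linarith
    · exact h'
  apply hu
  funext y
  refine abs_eq_zero.1 (zero_propagates G hG (fun y => |u y|) (fun _ => abs_nonneg _) ?_ x hux y)
  intro z
  rcases mul_eq_zero.1 (z1 z (Finset.mem_univ _)) with h' | h'
  · exact absurd h' (hv z).ne'
  · linarith

/-- If all eigenvalues are at most `2`, a nonnegative superinvariant vector is invariant. -/
theorem super_eq {V : Type} [Fintype V] [DecidableEq V] (G : SimpleGraph V)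
    (hle : ∀ μ : ℝ, IsAdjEigenvalue G μ → μ ≤ 2) (w : V → ℝ) (hw : ∀ x, 0 ≤ w x)
    (h : ∀ x, 2 * w x ≤ nbrSum G w x) (x : V) : nbrSum G w x = 2 * w x := by
  classical
  set M : Matrix V V ℝ := (2 : ℝ) • (1 : Matrix V V ℝ) - adjMat G with hM
  have hMv : ∀ v : V → ℝ, M.mulVec v = fun x => 2 * v x - nbrSum G v x := by
    intro v
    funext x
    rw [hM, Matrix.sub_mulVec, Matrix.smul_mulVec, Matrix.one_mulVec]
    simp [adjMat_mulVec]
  have hherm : M.IsHermitian := by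
    refine Matrix.IsHermitian.ext fun i j => ?_
    simp [hM, adjMat, Matrix.one_apply, G.adj_comm i j, eq_comm]
  have hpsd : M.PosSemidef := by
    rw [hherm.posSemidef_iff_eigenvalues_nonneg]
    intro j
    have h1 := hherm.mulVec_eigenvectorBasis j
    have h2 : IsAdjEigenvalue G (2 - hherm.eigenvalues j) := by
      rw [isAdjEigenvalue_iff]
      refine ⟨⇑(hherm.eigenvectorBasis j), ?_, ?_⟩
      · intro h0
        have := hherm.eigenvectorBasis.orthonormal.ne_zero j
        apply this
        ext i
        exact congrFun h0 i
      · intro x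
        rw [hMv] at h1
        have := congrFun h1 x
        simp only [Pi.smul_apply, smul_eq_mul] at this
        linarith
    have := hle _ h2
    simp only [Pi.zero_apply]
    linarith
  have hq : star w ⬝ᵥ M.mulVec w = 0 := by
    refine le_antisymm ?_ ?_
    · rw [hMv]
      refine Finset.sum_nonpos fun x _ => ?_
      have := h x
      simp only [star_trivial]
      exact mul_nonpos_of_nonneg_of_nonpos (hw x) (by linarith)
    · exact hpsd.dotProduct_mulVec_nonneg w
  have := congrFun ((hpsd.dotProduct_mulVec_zero_iff w).1 hq) x
  rw [hMv] at this
  simp only [Pi.zero_apply] at this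
  linarith

/-- A graph all of whose eigenvalues are at most `2` which contains a graph with a positive
eigenvector for `2` is isomorphic to it. -/
theorem iso_of_contained {V W : Type} [Fintype V] [DecidableEq V] [Fintype W] [Nonempty W]
    (G : SimpleGraph V) (hG : G.Connected)
    (hle : ∀ μ : ℝ, IsAdjEigenvalue G μ → μ ≤ 2) (H : SimpleGraph W)
    (v : W → ℝ) (hv : ∀ i, 0 < v i) (hev : ∀ i, nbrSum H v i = 2 * v i)
    (f : W → V) (hf : Function.Injective f) (hom : ∀ i j, H.Adj i j → G.Adj (f i) (f j)) :
    Nonempty (G ≃g H) := by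
  classical
  set w : V → ℝ := Function.extend f v 0 with hwdef
  have hwf : ∀ i, w (f i) = v i := fun i => hf.extend_apply v 0 i
  have hwo : ∀ x, (¬ ∃ i, f i = x) → w x = 0 := fun x hx => by
    rw [hwdef, Function.extend_apply' _ _ _ hx]; rfl
  have hw0 : ∀ x, 0 ≤ w x := by
    intro x
    by_cases hx : ∃ i, f i = x
    · obtain ⟨i, rfl⟩ := hx
      rw [hwf]; exact (hv i).le
    · rw [hwo x hx]
  have key : ∀ i, nbrSum G w (f i) = ∑ j, if G.Adj (f i) (f j) then v j else 0 := by
    intro i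
    unfold nbrSum
    rw [← Finset.sum_subset (Finset.subset_univ (Finset.univ.image f)),
      Finset.sum_image (fun a _ b _ h => hf h)]
    · simp only [hwf]
    · intro x _ hx
      have : w x = 0 := hwo x (by simpa using hx)
      simp [this]
  have hsup : ∀ x, 2 * w x ≤ nbrSum G w x := by
    intro x
    by_cases hx : ∃ i, f i = x
    · obtain ⟨i, rfl⟩ := hx
      rw [key, hwf, ← hev]
      refine Finset.sum_le_sum fun j _ => ?_
      have := hom i j
      have := (hv j).le
      split_ifs <;> first | exact le_rfl | tauto
    · rw [hwo x hx, mul_zero]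
      refine Finset.sum_nonneg fun y _ => ?_
      split_ifs
      · exact hw0 y
      · exact le_rfl
  have heq := super_eq G hle w hw0 hsup
  have hsurj : Function.Surjective f := by
    intro x
    by_contra hx
    have := zero_propagates G hG w hw0 heq x (hwo x hx) (f (Classical.arbitrary W))
    rw [hwf] at this
    exact (hv _).ne' this
  refine ⟨(RelIso.mk (Equiv.ofBijective f ⟨hf, hsurj⟩) ?_ : H ≃g G).symm⟩
  intro i j
  refine ⟨fun hadj => ?_, hom i j⟩
  change G.Adj (f i) (f j) at hadj
  by_contra hn
  have h1 := heq (f i)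
  rw [key, hwf, ← hev] at h1
  unfold nbrSum at h1
  refine absurd h1 (ne_of_gt (Finset.sum_lt_sum (fun k _ => ?_) ⟨j, Finset.mem_univ _, ?_⟩))
  · have := hom i k
    have := (hv k).le
    split_ifs <;> first | exact le_rfl | tauto
  · simp [hn, hadj, hv j]

theorem nbrSum_iso {V W : Type} [Fintype V] [Fintype W] {G : SimpleGraph V} {H : SimpleGraph W}
    (e : G ≃g H) (v : W → ℝ) (x : V) : nbrSum G (fun y => v (e y)) x = nbrSum H v (e x) := by
  classical
  unfold nbrSum
  rw [← e.toEquiv.sum_comp]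
  refine Finset.sum_congr rfl fun y _ => ?_
  have : H.Adj (e x) (e y) ↔ G.Adj x y := e.map_adj_iff
  simp only [RelIso.coe_fn_toEquiv, this]

/-! ### Vectors on the diagrams -/

/-- There is a positive vector with `A v = 2 v`. -/
def HasInv {V : Type} [Fintype V] (G : SimpleGraph V) : Prop :=
  ∃ v : V → ℝ, (∀ x, 0 < v x) ∧ ∀ x, nbrSum G v x = 2 * v x

/-- There is a positive vector with `A v ≤ 2 v`, strict somewhere. -/
def HasSub {V : Type} [Fintype V] (G : SimpleGraph V) : Prop :=
  ∃ v : V → ℝ, (∀ x, 0 < v x) ∧ (∀ x, nbrSum G v x ≤ 2 * v x) ∧ ∃ x, nbrSum G v x < 2 * v x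

theorem HasInv.of_iso {V W : Type} [Fintype V] [Fintype W] {G : SimpleGraph V}
    {H : SimpleGraph W} (e : G ≃g H) (h : HasInv H) : HasInv G := by
  obtain ⟨v, h1, h2⟩ := h
  exact ⟨fun y => v (e y), fun x => h1 _, fun x => by rw [nbrSum_iso, h2]⟩

theorem HasSub.of_iso {V W : Type} [Fintype V] [Fintype W] {G : SimpleGraph V}
    {H : SimpleGraph W} (e : G ≃g H) (h : HasSub H) : HasSub G := by
  obtain ⟨v, h1, h2, x, h3⟩ := h
  refine ⟨fun y => v (e y), fun x => h1 _, fun x => by rw [nbrSum_iso]; exact h2 _, e.symm x, ?_⟩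
  rw [nbrSum_iso]
  simpa using h3

theorem nbrSum_fin {n : ℕ} (H : SimpleGraph (Fin n)) (g : ℕ → ℝ) (i : Fin n) (s : Finset ℕ)
    (hs : ∀ k ∈ s, k < n) (h : ∀ j : Fin n, H.Adj i j ↔ (j : ℕ) ∈ s) :
    nbrSum H (fun j => g j) i = ∑ k ∈ s, g k := by
  classical
  unfold nbrSum
  simp only [h]
  rw [← Finset.sum_filter]
  refine Finset.sum_bij (fun j _ => (j : ℕ)) ?_ ?_ ?_ ?_
  · intro j hj; simpa using hj
  · intro a _ b _ hab; exact Fin.ext hab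
  · intro k hk; exact ⟨⟨k, hs k hk⟩, by simpa using hk, rfl⟩
  · intro j _; rfl

theorem hasInv_cycle (n : ℕ) (hn : 2 ≤ n) : HasInv (cycleGraph (n + 1)) := by
  classical
  obtain ⟨m, rfl⟩ : ∃ m, n = m + 2 := ⟨n - 2, by omega⟩
  refine ⟨fun _ => 1, fun _ => one_pos, fun x => ?_⟩
  have h := cycleGraph_degree_three_le (n := m) (v := x)
  rw [← SimpleGraph.card_neighborFinset_eq_degree, SimpleGraph.neighborFinset_eq_filter] at h
  unfold nbrSum
  simp only []
  rw [← Finset.sum_filter, Finset.sum_const, nsmul_eq_mul]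
  have h' : (Finset.card {y | (cycleGraph (m + 2 + 1)).Adj x y} : ℝ) = 2 := by
    have := congrArg (Nat.cast : ℕ → ℝ) h
    rw [Nat.cast_ofNat] at this
    rw [← this]
  rw [h']

theorem hasSub_path (n : ℕ) (hn : 1 ≤ n) : HasSub (pathGraph n) := by
  have h0 : nbrSum (pathGraph n) (fun _ => 1) ⟨0, hn⟩ ≤ 1 := by
    by_cases h : n = 1
    · rw [nbrSum_fin (pathGraph n) (fun _ => 1) _ ∅ (by simp)]
      · simp
      · intro j; have := j.2; simp [pathGraph_adj]; omega
    · rw [nbrSum_fin (pathGraph n) (fun _ => 1) _ {1} (by simp; omega)]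
      · simp
      · intro j; have := j.2; simp [pathGraph_adj]; omega
  refine ⟨fun _ => 1, fun _ => one_pos, fun i => ?_, ⟨0, hn⟩, by linarith⟩
  by_cases hi : i = ⟨0, hn⟩
  · rw [hi]; linarith
  have hi0 : (i : ℕ) ≠ 0 := fun h => hi (Fin.ext h)
  have hi2 := i.2
  by_cases h : (i : ℕ) + 1 = n
  · rw [nbrSum_fin (pathGraph n) (fun _ => 1) _ {(i : ℕ) - 1} (by simp; omega)]
    · simp
    · intro j; have := j.2; simp [pathGraph_adj]; omega
  · rw [nbrSum_fin (pathGraph n) (fun _ => 1) _ {(i : ℕ) - 1, (i : ℕ) + 1} (by simp; omega)]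
    · rw [Finset.sum_pair (by omega)]; norm_num
    · intro j; have := j.2; simp [pathGraph_adj]; omega

theorem typeD_adj {n : ℕ} (i j : Fin n) : (typeD n).Adj i j ↔
    (i : ℕ) ≠ j ∧ ((((i : ℕ) + 1 = j ∧ (j : ℕ) ≤ n - 2) ∨ ((i : ℕ) = n - 3 ∧ (j : ℕ) = n - 1)) ∨
    (((j : ℕ) + 1 = i ∧ (i : ℕ) ≤ n - 2) ∨ ((j : ℕ) = n - 3 ∧ (i : ℕ) = n - 1))) := by
  simp [typeD, SimpleGraph.fromRel_adj, Fin.ext_iff]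

theorem typeDAffine_adj {n : ℕ} (i j : Fin (n + 1)) : (typeDAffine n).Adj i j ↔
    (i : ℕ) ≠ j ∧ ((((i : ℕ) + 1 = j ∧ (j : ℕ) ≤ n - 2) ∨ ((i : ℕ) = n - 3 ∧ (j : ℕ) = n - 1) ∨
      ((i : ℕ) = 1 ∧ (j : ℕ) = n)) ∨
    (((j : ℕ) + 1 = i ∧ (i : ℕ) ≤ n - 2) ∨ ((j : ℕ) = n - 3 ∧ (i : ℕ) = n - 1) ∨
      ((j : ℕ) = 1 ∧ (i : ℕ) = n))) := by
  simp [typeDAffine, SimpleGraph.fromRel_adj, Fin.ext_iff]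

theorem hasSub_D (n : ℕ) (hn : 4 ≤ n) : HasSub (typeD n) := by
  set g : ℕ → ℝ := fun k => if k + 2 < n then 2 else 1 with hg
  have g2 : ∀ k, k + 2 < n → g k = 2 := fun k hk => if_pos hk
  have g1 : ∀ k, ¬ (k + 2 < n) → g k = 1 := fun k hk => if_neg hk
  have h0 : nbrSum (typeD n) (fun j => g j) ⟨0, by omega⟩ = 2 := by
    rw [nbrSum_fin (typeD n) g _ {1} (by intro k hk; simp at hk; omega)]
    · rw [Finset.sum_singleton, g2 _ (by omega)]
    · intro j; have := j.2; simp only [typeD_adj, Finset.mem_singleton]; omega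
  refine ⟨fun j => g j, fun j => ?_, fun i => ?_, ⟨0, by omega⟩, ?_⟩
  · simp only [hg]; split_ifs <;> norm_num
  · have hi := i.2
    change _ ≤ 2 * g i
    by_cases c0 : (i : ℕ) = 0
    · have : i = ⟨0, by omega⟩ := Fin.ext c0
      rw [this, h0, g2 _ (by change 0 + 2 < n; omega)]; norm_num
    by_cases c1 : (i : ℕ) + 3 < n
    · rw [nbrSum_fin (typeD n) g _ {(i : ℕ) - 1, (i : ℕ) + 1} (by intro k hk; simp at hk; omega)]
      · rw [Finset.sum_pair (by omega), g2 _ (by omega), g2 _ (by omega), g2 _ (by omega)]; norm_num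
      · intro j; have := j.2; simp only [typeD_adj, Finset.mem_insert, Finset.mem_singleton]; omega
    by_cases c2 : (i : ℕ) + 3 = n
    · rw [nbrSum_fin (typeD n) g _ {(i : ℕ) - 1, (i : ℕ) + 1, (i : ℕ) + 2} (by intro k hk; simp at hk; omega)]
      · rw [Finset.sum_insert (by simp; omega), Finset.sum_pair (by omega), g2 _ (by omega),
          g1 _ (by omega), g1 _ (by omega), g2 _ (by omega)]; norm_num
      · intro j; have := j.2; simp only [typeD_adj, Finset.mem_insert, Finset.mem_singleton]; omega
    · rw [nbrSum_fin (typeD n) g _ {n - 3} (by intro k hk; simp at hk; omega)]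
      · rw [Finset.sum_singleton, g2 _ (by omega), g1 _ (by omega)]; norm_num
      · intro j; have := j.2; simp only [typeD_adj, Finset.mem_singleton]; omega
  · change _ < 2 * g 0
    rw [h0, g2 _ (by omega)]; norm_num

theorem hasInv_D (n : ℕ) (hn : 4 ≤ n) : HasInv (typeDAffine n) := by
  set g : ℕ → ℝ := fun k => if k + 2 < n ∧ k ≠ 0 then 2 else 1 with hg
  have g2 : ∀ k, k + 2 < n ∧ k ≠ 0 → g k = 2 := fun k hk => if_pos hk
  have g1 : ∀ k, ¬ (k + 2 < n ∧ k ≠ 0) → g k = 1 := fun k hk => if_neg hk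
  refine ⟨fun j => g j, fun j => ?_, fun i => ?_⟩
  · simp only [hg]; split_ifs <;> norm_num
  · have hi := i.2
    change _ = 2 * g i
    by_cases c0 : (i : ℕ) = 0 ∨ (i : ℕ) = n
    · rw [nbrSum_fin (typeDAffine n) g _ {1} (by intro k hk; simp at hk; omega)]
      · rw [Finset.sum_singleton, g2 _ (by omega), g1 _ (by omega)]; norm_num
      · intro j; have := j.2; simp only [typeDAffine_adj, Finset.mem_singleton]; omega
    by_cases c1 : (i : ℕ) + 2 = n ∨ (i : ℕ) + 1 = n
    · rw [nbrSum_fin (typeDAffine n) g _ {n - 3} (by intro k hk; simp at hk; omega)]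
      · rw [Finset.sum_singleton, g2 _ (by omega), g1 _ (by omega)]; norm_num
      · intro j; have := j.2; simp only [typeDAffine_adj, Finset.mem_singleton]; omega
    by_cases c2 : n = 4
    · rw [nbrSum_fin (typeDAffine n) g _ {0, 2, 3, 4} (by intro k hk; simp at hk; omega)]
      · rw [Finset.sum_insert (by simp), Finset.sum_insert (by simp), Finset.sum_pair (by omega),
          g1 _ (by omega), g1 _ (by omega), g1 _ (by omega), g1 _ (by omega), g2 _ (by omega)]
        norm_num
      · intro j; have := j.2
        simp only [typeDAffine_adj, Finset.mem_insert, Finset.mem_singleton]; omega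
    by_cases c3 : (i : ℕ) = 1
    · rw [nbrSum_fin (typeDAffine n) g _ {0, 2, n} (by intro k hk; simp at hk; omega)]
      · rw [Finset.sum_insert (by simp; omega), Finset.sum_pair (by omega),
          g1 _ (by omega), g2 _ (by omega), g1 _ (by omega), g2 _ (by omega)]
        norm_num
      · intro j; have := j.2
        simp only [typeDAffine_adj, Finset.mem_insert, Finset.mem_singleton]; omega
    by_cases c4 : (i : ℕ) + 3 = n
    · rw [nbrSum_fin (typeDAffine n) g _ {(i : ℕ) - 1, (i : ℕ) + 1, (i : ℕ) + 2} (by intro k hk; simp at hk; omega)]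
      · rw [Finset.sum_insert (by simp; omega), Finset.sum_pair (by omega), g2 _ (by omega),
          g1 _ (by omega), g1 _ (by omega), g2 _ (by omega)]; norm_num
      · intro j; have := j.2
        simp only [typeDAffine_adj, Finset.mem_insert, Finset.mem_singleton]; omega
    · rw [nbrSum_fin (typeDAffine n) g _ {(i : ℕ) - 1, (i : ℕ) + 1} (by intro k hk; simp at hk; omega)]
      · rw [Finset.sum_pair (by omega), g2 _ (by omega), g2 _ (by omega), g2 _ (by omega)]; norm_num
      · intro j; have := j.2
        simp only [typeDAffine_adj, Finset.mem_insert, Finset.mem_singleton]; omega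

theorem hasInv_E6 : HasInv typeE6Affine := by
  refine ⟨![1, 2, 3, 2, 1, 2, 1], fun i => ?_, fun i => ?_⟩
  · fin_cases i <;> simp
  · fin_cases i <;> simp [nbrSum, typeE6Affine, Fin.sum_univ_succ] <;> norm_num

theorem hasInv_E7 : HasInv typeE7Affine := by
  refine ⟨![2, 3, 4, 3, 2, 1, 2, 1], fun i => ?_, fun i => ?_⟩
  · fin_cases i <;> simp
  · fin_cases i <;> simp [nbrSum, typeE7Affine, Fin.sum_univ_succ] <;> norm_num

theorem hasInv_E8 : HasInv typeE8Affine := by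
  refine ⟨![2, 4, 6, 5, 4, 3, 2, 3, 1], fun i => ?_, fun i => ?_⟩
  · fin_cases i <;> simp
  · fin_cases i <;> simp [nbrSum, typeE8Affine, Fin.sum_univ_succ] <;> norm_num

theorem hasSub_E6 : HasSub (typeE 6) := by
  refine ⟨![2, 4, 6, 5, 4, 3], fun i => ?_, fun i => ?_, 4, ?_⟩
  · fin_cases i <;> simp
  · fin_cases i <;> simp [nbrSum, typeE, Fin.sum_univ_succ] <;> norm_num
  · simp [nbrSum, typeE, Fin.sum_univ_succ]; norm_num

theorem hasSub_E7 : HasSub (typeE 7) := by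
  refine ⟨![2, 4, 6, 5, 4, 3, 3], fun i => ?_, fun i => ?_, 5, ?_⟩
  · fin_cases i <;> simp
  · fin_cases i <;> simp [nbrSum, typeE, Fin.sum_univ_succ] <;> norm_num
  · simp [nbrSum, typeE, Fin.sum_univ_succ]; norm_num

theorem hasSub_E8 : HasSub (typeE 8) := by
  refine ⟨![2, 4, 6, 5, 4, 3, 2, 3], fun i => ?_, fun i => ?_, 6, ?_⟩
  · fin_cases i <;> simp
  · fin_cases i <;> simp [nbrSum, typeE, Fin.sum_univ_succ] <;> norm_num
  · simp [nbrSum, typeE, Fin.sum_univ_succ]; norm_num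

theorem IsADE.hasSub {V : Type} [Fintype V] {G : SimpleGraph V} (h : IsADE G) : HasSub G := by
  rcases h with ⟨n, hn, ⟨e⟩⟩ | ⟨n, hn, ⟨e⟩⟩ | ⟨⟨e⟩⟩ | ⟨⟨e⟩⟩ | ⟨⟨e⟩⟩
  · exact (hasSub_path n hn).of_iso e
  · exact (hasSub_D n hn).of_iso e
  · exact hasSub_E6.of_iso e
  · exact hasSub_E7.of_iso e
  · exact hasSub_E8.of_iso e

theorem IsAffineADE.hasInv {V : Type} [Fintype V] {G : SimpleGraph V} (h : IsAffineADE G) :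
    HasInv G := by
  rcases h with ⟨n, hn, ⟨e⟩⟩ | ⟨n, hn, ⟨e⟩⟩ | ⟨⟨e⟩⟩ | ⟨⟨e⟩⟩ | ⟨⟨e⟩⟩
  · exact (hasInv_cycle n hn).of_iso e
  · exact (hasInv_D n hn).of_iso e
  · exact hasInv_E6.of_iso e
  · exact hasInv_E7.of_iso e
  · exact hasInv_E8.of_iso e

/-! ### Combinatorial part -/

/-- `G` contains a copy of an affine diagram. -/
def ContainsAffine {V : Type} (G : SimpleGraph V) : Prop :=
  ∃ (m : ℕ) (H : SimpleGraph (Fin m)), IsAffineADE H ∧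
    ∃ f : Fin m → V, Function.Injective f ∧ ∀ i j, H.Adj i j → G.Adj (f i) (f j)

/-- `G` is an ADE diagram or contains an affine one. -/
def ADEorContains {V : Type} (G : SimpleGraph V) : Prop := IsADE G ∨ ContainsAffine G

theorem ContainsAffine.map {V W : Type} {G : SimpleGraph V} {H : SimpleGraph W}
    (h : ContainsAffine G) (f : V → W) (hf : Function.Injective f)
    (hom : ∀ i j, G.Adj i j → H.Adj (f i) (f j)) : ContainsAffine H := by
  obtain ⟨m, K, hK, g, hg, hgh⟩ := h
  exact ⟨m, K, hK, f ∘ g, hf.comp hg, fun i j hij => hom _ _ (hgh _ _ hij)⟩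

theorem IsADE.of_iso {V W : Type} {G : SimpleGraph V} {H : SimpleGraph W} (e : G ≃g H)
    (h : IsADE H) : IsADE G := by
  rcases h with ⟨n, hn, ⟨e'⟩⟩ | ⟨n, hn, ⟨e'⟩⟩ | ⟨⟨e'⟩⟩ | ⟨⟨e'⟩⟩ | ⟨⟨e'⟩⟩
  · exact Or.inl ⟨n, hn, ⟨e.trans e'⟩⟩
  · exact Or.inr (Or.inl ⟨n, hn, ⟨e.trans e'⟩⟩)
  · exact Or.inr (Or.inr (Or.inl ⟨e.trans e'⟩))
  · exact Or.inr (Or.inr (Or.inr (Or.inl ⟨e.trans e'⟩)))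
  · exact Or.inr (Or.inr (Or.inr (Or.inr ⟨e.trans e'⟩)))

theorem IsAffineADE.of_iso {V W : Type} {G : SimpleGraph V} {H : SimpleGraph W} (e : G ≃g H)
    (h : IsAffineADE H) : IsAffineADE G := by
  rcases h with ⟨n, hn, ⟨e'⟩⟩ | ⟨n, hn, ⟨e'⟩⟩ | ⟨⟨e'⟩⟩ | ⟨⟨e'⟩⟩ | ⟨⟨e'⟩⟩
  · exact Or.inl ⟨n, hn, ⟨e.trans e'⟩⟩
  · exact Or.inr (Or.inl ⟨n, hn, ⟨e.trans e'⟩⟩)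
  · exact Or.inr (Or.inr (Or.inl ⟨e.trans e'⟩))
  · exact Or.inr (Or.inr (Or.inr (Or.inl ⟨e.trans e'⟩)))
  · exact Or.inr (Or.inr (Or.inr (Or.inr ⟨e.trans e'⟩)))

theorem ADEorContains.of_iso {V W : Type} {G : SimpleGraph V} {H : SimpleGraph W} (e : G ≃g H)
    (h : ADEorContains H) : ADEorContains G := by
  rcases h with h | h
  · exact Or.inl (h.of_iso e)
  · exact Or.inr (h.map e.symm e.symm.injective fun i j hij => e.symm.map_adj_iff.2 hij)

theorem isAffine_D (n : ℕ) (hn : 4 ≤ n) : IsAffineADE (typeDAffine n) :=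
  Or.inr (Or.inl ⟨n, hn, ⟨RelIso.refl _⟩⟩)
theorem isAffine_E6 : IsAffineADE typeE6Affine := Or.inr (Or.inr (Or.inl ⟨RelIso.refl _⟩))
theorem isAffine_E7 : IsAffineADE typeE7Affine :=
  Or.inr (Or.inr (Or.inr (Or.inl ⟨RelIso.refl _⟩)))
theorem isAffine_E8 : IsAffineADE typeE8Affine :=
  Or.inr (Or.inr (Or.inr (Or.inr ⟨RelIso.refl _⟩)))
theorem isADE_A (n : ℕ) (hn : 1 ≤ n) : IsADE (pathGraph n) := Or.inl ⟨n, hn, ⟨RelIso.refl _⟩⟩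
theorem isADE_D (n : ℕ) (hn : 4 ≤ n) : IsADE (typeD n) := Or.inr (Or.inl ⟨n, hn, ⟨RelIso.refl _⟩⟩)
theorem isADE_E (n : ℕ) (hn : n = 6 ∨ n = 7 ∨ n = 8) : IsADE (typeE n) := by
  rcases hn with rfl | rfl | rfl
  · exact Or.inr (Or.inr (Or.inl ⟨RelIso.refl _⟩))
  · exact Or.inr (Or.inr (Or.inr (Or.inl ⟨RelIso.refl _⟩)))
  · exact Or.inr (Or.inr (Or.inr (Or.inr ⟨RelIso.refl _⟩)))

/-- A bijection given by a formula on natural numbers. -/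
theorem mkIso {n : ℕ} (G H : SimpleGraph (Fin n)) (f : ℕ → ℕ) (hlt : ∀ i, i < n → f i < n)
    (inj : ∀ i j, i < n → j < n → f i = f j → i = j)
    (adj : ∀ i j (hi : i < n) (hj : j < n),
      H.Adj ⟨f i, hlt i hi⟩ ⟨f j, hlt j hj⟩ ↔ G.Adj ⟨i, hi⟩ ⟨j, hj⟩) : Nonempty (G ≃g H) := by
  have hinj : Function.Injective (fun i : Fin n => (⟨f i, hlt i i.2⟩ : Fin n)) := by
    intro a b hab
    exact Fin.ext (inj a b a.2 b.2 (by simpa using hab))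
  refine ⟨⟨Equiv.ofBijective _ (Finite.injective_iff_bijective.1 hinj), ?_⟩⟩
  intro a b
  exact adj a b a.2 b.2

theorem mkContains {m n : ℕ} {H : SimpleGraph (Fin m)} (G : SimpleGraph (Fin n))
    (hH : IsAffineADE H) (f : ℕ → ℕ) (hlt : ∀ i, i < m → f i < n)
    (inj : ∀ i j, i < m → j < m → f i = f j → i = j)
    (adj : ∀ i j (hi : i < m) (hj : j < m),
      H.Adj ⟨i, hi⟩ ⟨j, hj⟩ → G.Adj ⟨f i, hlt i hi⟩ ⟨f j, hlt j hj⟩) : ADEorContains G := by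
  refine Or.inr ⟨m, H, hH, fun i => ⟨f i, hlt i i.2⟩, ?_, fun a b => adj a b a.2 b.2⟩
  intro a b hab
  exact Fin.ext (inj a b a.2 b.2 (by simpa using hab))

/-- Attach a leaf (the last vertex) to the vertex `s`. -/
def addLeaf {n : ℕ} (K : SimpleGraph (Fin n)) (s : Fin n) : SimpleGraph (Fin (n + 1)) where
  Adj i j := (∃ (hi : (i : ℕ) < n) (hj : (j : ℕ) < n), K.Adj ⟨i, hi⟩ ⟨j, hj⟩) ∨
    ((i : ℕ) = s ∧ (j : ℕ) = n) ∨ ((j : ℕ) = s ∧ (i : ℕ) = n)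
  symm := ⟨by
    rintro i j (⟨hi, hj, h⟩ | h | h)
    · exact Or.inl ⟨hj, hi, h.symm⟩
    · exact Or.inr (Or.inr h)
    · exact Or.inr (Or.inl h)⟩
  loopless := ⟨by
    rintro i (⟨hi, hj, h⟩ | h | h)
    · exact h.ne rfl
    · have := s.2; omega
    · have := s.2; omega⟩

theorem addLeaf_path_adj {n : ℕ} (s : Fin n) (i j : Fin (n + 1)) :
    (addLeaf (pathGraph n) s).Adj i j ↔
    ((i : ℕ) < n ∧ (j : ℕ) < n ∧ ((i : ℕ) + 1 = j ∨ (j : ℕ) + 1 = i)) ∨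
    ((i : ℕ) = s ∧ (j : ℕ) = n) ∨ ((j : ℕ) = s ∧ (i : ℕ) = n) := by
  simp only [addLeaf, pathGraph_adj, exists_prop]

theorem addLeaf_D_adj {n : ℕ} (s : Fin n) (i j : Fin (n + 1)) :
    (addLeaf (typeD n) s).Adj i j ↔
    ((i : ℕ) < n ∧ (j : ℕ) < n ∧ (i : ℕ) ≠ j ∧
      ((((i : ℕ) + 1 = j ∧ (j : ℕ) ≤ n - 2) ∨ ((i : ℕ) = n - 3 ∧ (j : ℕ) = n - 1)) ∨
      (((j : ℕ) + 1 = i ∧ (i : ℕ) ≤ n - 2) ∨ ((j : ℕ) = n - 3 ∧ (i : ℕ) = n - 1)))) ∨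
    ((i : ℕ) = s ∧ (j : ℕ) = n) ∨ ((j : ℕ) = s ∧ (i : ℕ) = n) := by
  simp only [addLeaf, typeD_adj, exists_prop]

theorem typeE_adj {n : ℕ} (i j : Fin n) : (typeE n).Adj i j ↔
    (i : ℕ) ≠ j ∧ ((((i : ℕ) + 1 = j ∧ (j : ℕ) ≤ n - 2) ∨ ((i : ℕ) = 2 ∧ (j : ℕ) = n - 1)) ∨
    (((j : ℕ) + 1 = i ∧ (i : ℕ) ≤ n - 2) ∨ ((j : ℕ) = 2 ∧ (i : ℕ) = n - 1))) := by
  simp [typeE, SimpleGraph.fromRel_adj, Fin.ext_iff]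

theorem typeE6Affine_adj (i j : Fin 7) : typeE6Affine.Adj i j ↔
    (i : ℕ) ≠ j ∧ ((((i : ℕ) + 1 = j ∧ (j : ℕ) ≤ 4) ∨ ((i : ℕ) = 2 ∧ (j : ℕ) = 5) ∨
      ((i : ℕ) = 5 ∧ (j : ℕ) = 6)) ∨
    (((j : ℕ) + 1 = i ∧ (i : ℕ) ≤ 4) ∨ ((j : ℕ) = 2 ∧ (i : ℕ) = 5) ∨
      ((j : ℕ) = 5 ∧ (i : ℕ) = 6))) := by
  simp [typeE6Affine, SimpleGraph.fromRel_adj, Fin.ext_iff]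

theorem typeE7Affine_adj (i j : Fin 8) : typeE7Affine.Adj i j ↔
    (i : ℕ) ≠ j ∧ ((((i : ℕ) + 1 = j ∧ (j : ℕ) ≤ 5) ∨ ((i : ℕ) = 2 ∧ (j : ℕ) = 6) ∨
      ((i : ℕ) = 0 ∧ (j : ℕ) = 7)) ∨
    (((j : ℕ) + 1 = i ∧ (i : ℕ) ≤ 5) ∨ ((j : ℕ) = 2 ∧ (i : ℕ) = 6) ∨
      ((j : ℕ) = 0 ∧ (i : ℕ) = 7))) := by
  simp only [typeE7Affine, SimpleGraph.fromRel_adj, ne_eq, Fin.ext_iff]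

theorem typeE8Affine_adj (i j : Fin 9) : typeE8Affine.Adj i j ↔
    (i : ℕ) ≠ j ∧ ((((i : ℕ) + 1 = j ∧ (j : ℕ) ≤ 6) ∨ ((i : ℕ) = 2 ∧ (j : ℕ) = 7) ∨
      ((i : ℕ) = 6 ∧ (j : ℕ) = 8)) ∨
    (((j : ℕ) + 1 = i ∧ (i : ℕ) ≤ 6) ∨ ((j : ℕ) = 2 ∧ (i : ℕ) = 7) ∨
      ((j : ℕ) = 6 ∧ (i : ℕ) = 8))) := by
  simp [typeE8Affine, SimpleGraph.fromRel_adj, Fin.ext_iff]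

/-- Leaf attached to a path, in the first half. -/
theorem leaf_path_half (n : ℕ) (s : Fin n) (hs : 2 * (s : ℕ) + 1 ≤ n) :
    ADEorContains (addLeaf (pathGraph n) s) := by
  have hsn := s.2
  by_cases s0 : (s : ℕ) = 0
  · obtain ⟨e⟩ := mkIso (addLeaf (pathGraph n) s) (pathGraph (n + 1))
      (fun i => if i = n then 0 else i + 1) (by grind) (by grind)
      (by intro i j hi hj; simp only [addLeaf_path_adj, pathGraph_adj]; grind)
    exact Or.inl ((isADE_A _ (by omega)).of_iso e)
  by_cases s1 : (s : ℕ) = 1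
  · obtain ⟨e⟩ := mkIso (addLeaf (pathGraph n) s) (typeD (n + 1))
      (fun i => if i = n then n else n - 1 - i) (by grind) (by grind)
      (by intro i j hi hj; simp only [addLeaf_path_adj, typeD_adj]; grind)
    exact Or.inl ((isADE_D _ (by omega)).of_iso e)
  by_cases s2 : (s : ℕ) = 2
  · by_cases hn : n ≤ 7
    · obtain ⟨e⟩ := mkIso (addLeaf (pathGraph n) s) (typeE (n + 1))
        (fun i => i) (by grind) (by grind)
        (by intro i j hi hj; simp only [addLeaf_path_adj, typeE_adj]; omega)
      exact Or.inl ((isADE_E _ (by omega)).of_iso e)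
    · exact mkContains _ isAffine_E8
        (fun i => if i = 7 then n else if i = 8 then 7 else i) (by grind) (by grind)
        (by intro i j hi hj; simp only [addLeaf_path_adj, typeE8Affine_adj]; grind)
  · exact mkContains _ isAffine_E7
        (fun i => if i = 6 then n else if i = 7 then s - 3 else s - 2 + i) (by grind) (by grind)
        (by intro i j hi hj; simp only [addLeaf_path_adj, typeE7Affine_adj]; grind)

theorem leaf_path (n : ℕ) (s : Fin n) : ADEorContains (addLeaf (pathGraph n) s) := by
  have hsn := s.2
  by_cases hs : 2 * (s : ℕ) + 1 ≤ n
  · exact leaf_path_half n s hs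
  · obtain ⟨e⟩ := mkIso (addLeaf (pathGraph n) s) (addLeaf (pathGraph n) ⟨n - 1 - s, by omega⟩)
      (fun i => if i = n then n else n - 1 - i) (by grind) (by grind)
      (by intro i j hi hj; simp only [addLeaf_path_adj]; grind)
    exact (leaf_path_half n _ (by simp; omega)).of_iso e

instance decAddLeaf {n : ℕ} (K : SimpleGraph (Fin n)) [DecidableRel K.Adj] (s : Fin n) :
    DecidableRel (addLeaf K s).Adj := fun i j =>
  inferInstanceAs (Decidable ((∃ (hi : (i : ℕ) < n) (hj : (j : ℕ) < n), K.Adj ⟨i, hi⟩ ⟨j, hj⟩) ∨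
    ((i : ℕ) = s ∧ (j : ℕ) = n) ∨ ((j : ℕ) = s ∧ (i : ℕ) = n)))
instance decE (n : ℕ) : DecidableRel (typeE n).Adj := fun i j =>
  decidable_of_iff _ (typeE_adj i j).symm
instance decD (n : ℕ) : DecidableRel (typeD n).Adj := fun i j =>
  decidable_of_iff _ (typeD_adj i j).symm
instance decDAff (n : ℕ) : DecidableRel (typeDAffine n).Adj := fun i j =>
  decidable_of_iff _ (typeDAffine_adj i j).symm
instance decE6Aff : DecidableRel typeE6Affine.Adj := fun i j =>
  decidable_of_iff _ (typeE6Affine_adj i j).symm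
instance decE7Aff : DecidableRel typeE7Affine.Adj := fun i j =>
  decidable_of_iff _ (typeE7Affine_adj i j).symm
instance decE8Aff : DecidableRel typeE8Affine.Adj := fun i j =>
  decidable_of_iff _ (typeE8Affine_adj i j).symm

theorem mkContains' {m : ℕ} {V : Type} {H : SimpleGraph (Fin m)} {G : SimpleGraph V}
    (hH : IsAffineADE H) (f : Fin m → V)
    (h : (∀ i j, f i = f j → i = j) ∧ ∀ i j, H.Adj i j → G.Adj (f i) (f j)) : ADEorContains G :=
  Or.inr ⟨m, H, hH, f, fun _ _ h' => h.1 _ _ h', h.2⟩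

theorem mkIso' {n : ℕ} {G H : SimpleGraph (Fin n)} (hH : IsADE H) (f : Fin n → Fin n)
    (h : (∀ i j, f i = f j → i = j) ∧ ∀ i j, H.Adj (f i) (f j) ↔ G.Adj i j) :
    ADEorContains G := by
  have hinj : Function.Injective f := fun _ _ h' => h.1 _ _ h'
  exact Or.inl (hH.of_iso
    ⟨Equiv.ofBijective _ (Finite.injective_iff_bijective.1 hinj), fun {a b} => h.2 a b⟩)

/-- Subtraction-free form of the adjacency in `D_n` plus a leaf. -/
theorem addLeaf_D_adj' {n : ℕ} (hn : 4 ≤ n) (s : Fin n) (i j : Fin (n + 1)) :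
    (addLeaf (typeD n) s).Adj i j ↔
    ((i : ℕ) + 1 = j ∧ (j : ℕ) + 2 ≤ n) ∨ ((i : ℕ) + 3 = n ∧ (j : ℕ) + 1 = n) ∨
    ((j : ℕ) + 1 = i ∧ (i : ℕ) + 2 ≤ n) ∨ ((j : ℕ) + 3 = n ∧ (i : ℕ) + 1 = n) ∨
    ((i : ℕ) = s ∧ (j : ℕ) = n) ∨ ((j : ℕ) = s ∧ (i : ℕ) = n) := by
  rw [addLeaf_D_adj]
  have := s.2
  constructor
  · rintro (⟨_, _, _, (⟨_, _⟩ | ⟨_, _⟩) | ⟨_, _⟩ | ⟨_, _⟩⟩ | ⟨_, _⟩ | ⟨_, _⟩) <;> omega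
  · rintro (⟨_, _⟩ | ⟨_, _⟩ | ⟨_, _⟩ | ⟨_, _⟩ | ⟨_, _⟩ | ⟨_, _⟩) <;> omega

theorem typeD_adj' {n : ℕ} (hn : 4 ≤ n) (i j : Fin n) :
    (typeD n).Adj i j ↔
    ((i : ℕ) + 1 = j ∧ (j : ℕ) + 2 ≤ n) ∨ ((i : ℕ) + 3 = n ∧ (j : ℕ) + 1 = n) ∨
    ((j : ℕ) + 1 = i ∧ (i : ℕ) + 2 ≤ n) ∨ ((j : ℕ) + 3 = n ∧ (i : ℕ) + 1 = n) := by
  rw [typeD_adj]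
  constructor
  · rintro ⟨_, (⟨_, _⟩ | ⟨_, _⟩) | ⟨_, _⟩ | ⟨_, _⟩⟩ <;> omega
  · rintro (⟨_, _⟩ | ⟨_, _⟩ | ⟨_, _⟩ | ⟨_, _⟩) <;> omega

theorem leaf_D_aux (n : ℕ) (hn : 4 ≤ n) (s : Fin n) (hs : (s : ℕ) + 2 = n) :
    ADEorContains (addLeaf (typeD n) s) := by
  by_cases h4 : n = 4
  · subst h4
    obtain rfl : s = 2 := Fin.ext (by omega)
    exact mkIso' (isADE_D 5 (by simp)) ![3, 2, 1, 4, 0] (by decide)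
  by_cases h7 : n ≤ 7
  · obtain ⟨e⟩ := mkIso (addLeaf (typeD n) s) (typeE (n + 1))
      (fun i => if i = n then 0 else if i = n - 1 then n else n - 1 - i) (by grind) (by grind)
      (by intro i j hi hj; simp only [addLeaf_D_adj, typeE_adj]; grind)
    exact Or.inl ((isADE_E _ (by omega)).of_iso e)
  · exact mkContains _ isAffine_E8
        (fun i => if i = 0 then n else if i = 7 then n - 1 else if i = 8 then n - 8 else n - 1 - i)
        (by grind) (by grind)
        (by
          intro i j hi hj h
          rw [typeE8Affine_adj] at h
          rw [addLeaf_D_adj' hn]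
          dsimp only at h ⊢
          clear hi hj
          rcases h with ⟨-, (⟨rfl, h⟩ | ⟨rfl, rfl⟩ | ⟨rfl, rfl⟩) |
            ⟨rfl, h⟩ | ⟨rfl, rfl⟩ | ⟨rfl, rfl⟩⟩
          · have h : i < 6 := by omega
            interval_cases i <;> simp <;> omega
          · simp; omega
          · simp; omega
          · have h : j < 6 := by omega
            interval_cases j <;> simp <;> omega
          · simp; omega
          · simp; omega)

theorem leaf_D (n : ℕ) (hn : 4 ≤ n) (s : Fin n) : ADEorContains (addLeaf (typeD n) s) := by
  have hsn := s.2
  by_cases s0 : (s : ℕ) = 0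
  · obtain ⟨e⟩ := mkIso (addLeaf (typeD n) s) (typeD (n + 1))
      (fun i => if i = n then 0 else i + 1) (by grind) (by grind)
      (by intro i j hi hj; simp only [addLeaf_D_adj' hn, typeD_adj' (show 4 ≤ n + 1 by omega)]; grind)
    exact Or.inl ((isADE_D _ (by omega)).of_iso e)
  by_cases s1 : (s : ℕ) + 2 = n
  · exact leaf_D_aux n hn s s1
  by_cases s2 : (s : ℕ) + 1 = n
  · obtain ⟨e⟩ := mkIso (addLeaf (typeD n) s) (addLeaf (typeD n) ⟨n - 2, by omega⟩)
      (fun i => if i = n - 2 then n - 1 else if i = n - 1 then n - 2 else i) (by grind) (by grind)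
      (by
        have key : ∀ i : ℕ, ∃ y, (if i = n - 2 then n - 1 else if i = n - 1 then n - 2 else i) = y ∧
            ((i + 2 = n ∧ y + 1 = n) ∨ (i + 1 = n ∧ y + 2 = n) ∨
              (i + 2 ≠ n ∧ i + 1 ≠ n ∧ y = i)) := by
          intro i
          refine ⟨_, rfl, ?_⟩
          split_ifs <;> omega
        intro i j hi hj
        rw [addLeaf_D_adj' hn, addLeaf_D_adj' hn]
        dsimp only
        obtain ⟨y, hy, hy'⟩ := key i
        obtain ⟨z, hz, hz'⟩ := key j
        rw [hy, hz]
        clear hy hz key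
        rcases hy' with hy | hy | hy <;> rcases hz' with hz | hz | hz <;> omega)
    exact (leaf_D_aux n hn _ (by simp; omega)).of_iso e
  · exact mkContains _ (isAffine_D (n - s + 1) (by omega))
        (fun i => if i = n - s + 1 then n else if i = n - s then n - 1 else s - 1 + i)
        (by grind) (by grind)
        (by intro i j hi hj; simp only [addLeaf_D_adj' hn, typeDAffine_adj]; grind)

theorem leaf_E6 (s : Fin 6) : ADEorContains (addLeaf (typeE 6) s) := by
  fin_cases s
  · exact mkIso' (isADE_E 7 (by simp)) ![4, 3, 2, 1, 0, 6, 5] (by decide)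
  · exact mkContains' (isAffine_D 5 (by simp)) ![0, 1, 2, 3, 5, 6] (by decide)
  · exact mkContains' (isAffine_D 4 (by simp)) ![1, 2, 3, 5, 6] (by decide)
  · exact mkContains' (isAffine_D 5 (by simp)) ![4, 3, 2, 1, 5, 6] (by decide)
  · exact mkIso' (isADE_E 7 (by simp)) ![0, 1, 2, 3, 4, 6, 5] (by decide)
  · exact mkContains' isAffine_E6 ![0, 1, 2, 3, 4, 5, 6] (by decide)

theorem leaf_E7 (s : Fin 7) : ADEorContains (addLeaf (typeE 7) s) := by
  fin_cases s
  · exact mkContains' isAffine_E7 ![0, 1, 2, 3, 4, 5, 6, 7] (by decide)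
  · exact mkContains' (isAffine_D 5 (by simp)) ![0, 1, 2, 3, 6, 7] (by decide)
  · exact mkContains' (isAffine_D 4 (by simp)) ![1, 2, 3, 6, 7] (by decide)
  · exact mkContains' (isAffine_D 5 (by simp)) ![4, 3, 2, 1, 6, 7] (by decide)
  · exact mkContains' (isAffine_D 6 (by simp)) ![5, 4, 3, 2, 1, 6, 7] (by decide)
  · exact mkIso' (isADE_E 8 (by simp)) ![0, 1, 2, 3, 4, 5, 7, 6] (by decide)
  · exact mkContains' isAffine_E6 ![0, 1, 2, 3, 4, 6, 7] (by decide)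

theorem leaf_E8 (s : Fin 8) : ADEorContains (addLeaf (typeE 8) s) := by
  fin_cases s
  · exact mkContains' isAffine_E7 ![0, 1, 2, 3, 4, 5, 7, 8] (by decide)
  · exact mkContains' (isAffine_D 5 (by simp)) ![0, 1, 2, 3, 7, 8] (by decide)
  · exact mkContains' (isAffine_D 4 (by simp)) ![1, 2, 3, 7, 8] (by decide)
  · exact mkContains' (isAffine_D 5 (by simp)) ![4, 3, 2, 1, 7, 8] (by decide)
  · exact mkContains' (isAffine_D 6 (by simp)) ![5, 4, 3, 2, 1, 7, 8] (by decide)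
  · exact mkContains' (isAffine_D 7 (by simp)) ![6, 5, 4, 3, 2, 1, 7, 8] (by decide)
  · exact mkContains' isAffine_E8 ![0, 1, 2, 3, 4, 5, 6, 7, 8] (by decide)
  · exact mkContains' isAffine_E6 ![0, 1, 2, 3, 4, 7, 8] (by decide)

/-- Two neighbours outside `x` joined avoiding `x` give a cycle. -/
theorem cycle_of_two {V : Type} (G : SimpleGraph V) (x : V)
    (hc : (G.induce ({x}ᶜ : Set V)).Connected) (a b : V) (hab : a ≠ b) (ha : G.Adj x a)
    (hb : G.Adj x b) : ContainsAffine G := by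
  classical
  obtain ⟨p, hp⟩ := (hc.preconnected ⟨a, ha.ne'⟩ ⟨b, hb.ne'⟩).exists_isPath
  have hlen : 1 ≤ p.length := by
    rcases Nat.eq_zero_or_pos p.length with h | h
    · have := SimpleGraph.Walk.eq_of_length_eq_zero h
      exact absurd (congrArg Subtype.val this) hab
    · exact h
  set k := p.length with hk
  set f : Fin (k + 1 + 1) → V := fun i => if (i : ℕ) ≤ k then (p.getVert i).1 else x with hf
  have fne : ∀ i : ℕ, (p.getVert i).1 ≠ x := fun i => (p.getVert i).2
  refine ⟨k + 1 + 1, cycleGraph (k + 1 + 1), Or.inl ⟨k + 1, by omega, ⟨RelIso.refl _⟩⟩, f, ?_, ?_⟩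
  · intro i j hij
    have hi := i.2
    have hj := j.2
    simp only [hf] at hij
    split_ifs at hij with h1 h2 h2
    · exact Fin.ext (hp.getVert_injOn h1 h2 (Subtype.ext hij))
    · exact absurd hij (fne _)
    · exact absurd hij.symm (fne _)
    · exact Fin.ext (by omega)
  · have key : ∀ u v : Fin (k + 1 + 1), u = v + 1 → G.Adj (f u) (f v) := by
      intro u v huv
      have hu := u.2
      have hv := v.2
      have hval := congrArg Fin.val huv
      rw [Fin.val_add_one] at hval
      split_ifs at hval with hl
      · have hvk : (v : ℕ) = k + 1 := by rw [hl]; rfl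
        have e1 : f u = a := by simp [hf, hval]
        have e2 : f v = x := by simp [hf, hvk]
        rw [e1, e2]; exact ha.symm
      · have hvk : (v : ℕ) ≠ k + 1 := fun h => hl (Fin.ext h)
        have e2 : f v = (p.getVert v).1 := by simp only [hf]; rw [if_pos (by omega)]
        by_cases hvl : (v : ℕ) = k
        · have e1 : f u = x := by simp only [hf]; rw [if_neg (by omega)]
          have e3 : f v = b := by rw [e2, hvl, hk, SimpleGraph.Walk.getVert_length]
          rw [e1, e3]; exact hb
        · have e1 : f u = (p.getVert (v + 1)).1 := by
            simp only [hf]; rw [if_pos (by omega), hval]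
          rw [e1, e2]
          have := p.adj_getVert_succ (i := v) (by omega)
          exact (SimpleGraph.induce_adj.1 this).symm
    intro u v huv
    rcases cycleGraph_adj.1 huv with h | h
    · exact key u v (by rw [← h]; abel)
    · exact (key v u (by rw [← h]; abel)).symm

theorem iso_addLeaf {V : Type} (G : SimpleGraph V) (x : V) {n : ℕ} (K : SimpleGraph (Fin n))
    (e : G.induce ({x}ᶜ : Set V) ≃g K) (a : V) (ha : G.Adj x a)
    (huniq : ∀ b, G.Adj x b → b = a) : Nonempty (G ≃g addLeaf K (e ⟨a, ha.ne'⟩)) := by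
  classical
  set g : Fin (n + 1) → V := fun i => if h : (i : ℕ) < n then (e.symm ⟨i, h⟩).1 else x with hg
  have g1 : ∀ (i : Fin (n + 1)) (h : (i : ℕ) < n), g i = (e.symm ⟨i, h⟩).1 := fun i h => dif_pos h
  have g2 : ∀ (i : Fin (n + 1)) (_ : ¬ (i : ℕ) < n), g i = x := fun i h => dif_neg h
  have gne : ∀ k : Fin n, (e.symm k).1 ≠ x := fun k => (e.symm k).2
  have hinj : Function.Injective g := by
    intro i j hij
    have hi2 := i.2
    have hj2 := j.2
    by_cases hi : (i : ℕ) < n <;> by_cases hj : (j : ℕ) < n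
    · rw [g1 i hi, g1 j hj] at hij
      have := e.symm.injective (Subtype.ext hij)
      exact Fin.ext (by simpa using this)
    · rw [g1 i hi, g2 j hj] at hij; exact absurd hij (gne _)
    · rw [g2 i hi, g1 j hj] at hij; exact absurd hij.symm (gne _)
    · exact Fin.ext (by omega)
  have hsurj : Function.Surjective g := by
    intro y
    by_cases hy : y = x
    · exact ⟨Fin.last n, by rw [g2 _ (by simp), hy]⟩
    · refine ⟨(e ⟨y, hy⟩).castSucc, ?_⟩
      rw [g1 _ (by simp)]
      simp
  have hx : ∀ k : Fin n, G.Adj x (e.symm k).1 ↔ (k : ℕ) = (e ⟨a, ha.ne'⟩ : Fin n) := by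
    intro k
    rw [← Fin.ext_iff]
    constructor
    · intro h
      have h1 := huniq _ h
      have h2 : e.symm k = ⟨a, ha.ne'⟩ := Subtype.ext h1
      rw [← h2]; simp
    · rintro rfl
      simpa using ha
  refine ⟨(⟨Equiv.ofBijective g ⟨hinj, hsurj⟩, ?_⟩ : addLeaf K (e ⟨a, ha.ne'⟩) ≃g G).symm⟩
  intro i j
  change G.Adj (g i) (g j) ↔ _
  have hi2 := i.2
  have hj2 := j.2
  have hs := (e ⟨a, ha.ne'⟩ : Fin n).2
  unfold addLeaf
  simp only
  by_cases hi : (i : ℕ) < n <;> by_cases hj : (j : ℕ) < n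
  · rw [g1 i hi, g1 j hj]
    have h1 : G.Adj (e.symm ⟨i, hi⟩).1 (e.symm ⟨j, hj⟩).1 ↔ K.Adj ⟨i, hi⟩ ⟨j, hj⟩ := by
      rw [← SimpleGraph.induce_adj]; exact e.symm.map_adj_iff
    rw [h1]
    constructor
    · intro h; exact Or.inl ⟨hi, hj, h⟩
    · rintro (⟨_, _, h⟩ | h | h)
      · exact h
      · omega
      · omega
  · rw [g1 i hi, g2 j hj, G.adj_comm, hx]
    constructor
    · intro h; exact Or.inr (Or.inl ⟨h, by omega⟩)
    · rintro (⟨_, h, _⟩ | h | h)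
      · exact absurd h hj
      · exact h.1
      · omega
  · rw [g2 i hi, g1 j hj, hx]
    constructor
    · intro h; exact Or.inr (Or.inr ⟨h, by omega⟩)
    · rintro (⟨h, _, _⟩ | h | h)
      · exact absurd h hi
      · omega
      · exact h.1
  · rw [g2 i hi, g2 j hj]
    constructor
    · intro h; exact absurd rfl h.ne
    · rintro (⟨h, _, _⟩ | h | h)
      · exact absurd h hi
      · omega
      · omega

/-- Every finite connected graph is an ADE diagram or contains an affine one. -/
theorem ade_or_contains (n : ℕ) : ∀ (V : Type) [Fintype V] (G : SimpleGraph V), G.Connected →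
    Fintype.card V = n + 1 → ADEorContains G := by
  classical
  induction n with
  | zero =>
    intro V _ G _ hcard
    have e : V ≃ Fin 1 := Fintype.equivFinOfCardEq hcard
    have hsub : Subsingleton V := e.injective.subsingleton
    refine Or.inl ((isADE_A 1 le_rfl).of_iso ⟨e, fun {a b} => ?_⟩)
    constructor
    · intro h; exact absurd (Subsingleton.elim _ _) h.ne
    · intro h; exact absurd (Subsingleton.elim _ _) h.ne
  | succ n ih =>
    intro V _ G hG hcard
    haveI : Nontrivial V := Fintype.one_lt_card_iff_nontrivial.1 (by omega)
    obtain ⟨x, hx⟩ := hG.exists_connected_induce_compl_singleton_of_finite_nontrivial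
    have hcard' : Fintype.card ({x}ᶜ : Set V) = n + 1 := by
      rw [Fintype.card_compl_set]; simp; omega
    obtain ⟨a, ha⟩ : ∃ a, G.Adj x a := by
      obtain ⟨y, hy⟩ := exists_ne x
      obtain ⟨p⟩ := hG.preconnected x y
      cases p with
      | nil => exact absurd rfl hy
      | cons h _ => exact ⟨_, h⟩
    rcases ih _ _ hx hcard' with h | h
    · by_cases huniq : ∀ b, G.Adj x b → b = a
      · rcases h with ⟨m, hm, ⟨e⟩⟩ | ⟨m, hm, ⟨e⟩⟩ | ⟨⟨e⟩⟩ | ⟨⟨e⟩⟩ | ⟨⟨e⟩⟩ <;>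
          obtain ⟨e'⟩ := iso_addLeaf G x _ e a ha huniq
        · exact (leaf_path m _).of_iso e'
        · exact (leaf_D m hm _).of_iso e'
        · exact (leaf_E6 _).of_iso e'
        · exact (leaf_E7 _).of_iso e'
        · exact (leaf_E8 _).of_iso e'
      · push Not at huniq
        obtain ⟨b, hb, hba⟩ := huniq
        exact Or.inr (cycle_of_two G x hx b a hba hb ha)
    · exact Or.inr (h.map Subtype.val Subtype.val_injective fun i j hij =>
        SimpleGraph.induce_adj.1 hij)

/-- Let `A` be the adjacency matrix of a finite connected undirected graph `G`.  Then the
largest eigenvalue of `A` is at most `2` if and only if `G` is one of the ADE Dynkin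
diagrams `A_n, D_n, E_6, E_7, E_8` or their affine versions; equivalently, the largest
eigenvalue equals `2` exactly for the affine diagrams `Â_n, D̂_n, Ê_6, Ê_7, Ê_8`. -/
theorem spectral_characterization_ADE {V : Type} [Fintype V] [DecidableEq V]
    [Nonempty V] (G : SimpleGraph V) (hconn : G.Connected) :
    ((∀ μ : ℝ, IsAdjEigenvalue G μ → μ ≤ 2) ↔ (IsADE G ∨ IsAffineADE G)) ∧
    (((∀ μ : ℝ, IsAdjEigenvalue G μ → μ ≤ 2) ∧ IsAdjEigenvalue G 2) ↔
      IsAffineADE G) := by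
  have hA : IsAffineADE G → (∀ μ : ℝ, IsAdjEigenvalue G μ → μ ≤ 2) ∧ IsAdjEigenvalue G 2 := by
    intro h
    obtain ⟨v, hv, he⟩ := h.hasInv
    refine ⟨eig_le_two G v hv fun x => (he x).le, (isAdjEigenvalue_iff G 2).2 ⟨v, ?_, he⟩⟩
    intro h0
    have := hv (Classical.arbitrary V)
    rw [h0] at this
    exact lt_irrefl _ this
  have hB : IsADE G → (∀ μ : ℝ, IsAdjEigenvalue G μ → μ ≤ 2) ∧ ¬ IsAdjEigenvalue G 2 := by
    intro h
    obtain ⟨v, hv, he, hs⟩ := h.hasSub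
    exact ⟨eig_le_two G v hv he, two_not_eig G hconn v hv he hs⟩
  have hC : (∀ μ : ℝ, IsAdjEigenvalue G μ → μ ≤ 2) → IsADE G ∨ IsAffineADE G := by
    intro hle
    have hpos : 0 < Fintype.card V := Fintype.card_pos
    rcases ade_or_contains (Fintype.card V - 1) V G hconn (by omega) with h | h
    · exact Or.inl h
    · obtain ⟨m, H, hH, f, hf, hom⟩ := h
      obtain ⟨v, hv, he⟩ := hH.hasInv
      have hne : Nonempty (Fin m) := by
        rcases hH with ⟨n, hn, ⟨e⟩⟩ | ⟨n, hn, ⟨e⟩⟩ | ⟨⟨e⟩⟩ | ⟨⟨e⟩⟩ | ⟨⟨e⟩⟩ <;> exact ⟨e.symm 0⟩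
      obtain ⟨e⟩ := iso_of_contained G hconn hle H v hv he f hf hom
      exact Or.inr (hH.of_iso e)
  refine ⟨⟨hC, ?_⟩, ⟨?_, hA⟩⟩
  · rintro (h | h)
    · exact (hB h).1
    · exact (hA h).1
  · rintro ⟨h1, h2⟩
    rcases hC h1 with h | h
    · exact absurd h2 (hB h).2
    · exact h
end

section
/- Let Γ be a finite group, R a representation with real-valued character, and m the McKay matrix m_{ij} = ⟨χ_R χ_i, χ_j⟩. Then for every conjugacy class with representative g, the vector v_g with components v_g(i) = χ_i(g) is an eigenvector of the transpose of m with eigenvalue χ_R(g). -/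
open CategoryTheory
open scoped ComplexConjugate

/-- The McKay matrix entry `m_{ij} = ⟨χ_R χ_i, χ_j⟩`. -/
noncomputable def mckayEntry (Γ : Type) [Group Γ] [Fintype Γ]
    (R V W : FDRep ℂ Γ) : ℂ :=
  (Fintype.card Γ : ℂ)⁻¹ *
    ∑ g : Γ, R.character g * V.character g * conj (W.character g)

open scoped ComplexOrder in
theorem rep_char_conj {Γ V : Type} [Group Γ] [Fintype Γ] [AddCommGroup V] [Module ℂ V]
    [FiniteDimensional ℂ V] (ρ : Representation ℂ Γ V) (g : Γ) :
    conj (ρ.character g) = ρ.character g⁻¹ := by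
  classical
  let b := Module.finBasis ℂ V
  let M : Γ → Matrix _ _ ℂ := fun h => LinearMap.toMatrix b b (ρ h)
  have hM : ∀ x y, M (x * y) = M x * M y := fun x y => by
    simp only [M, map_mul]; exact LinearMap.toMatrix_mul b _ _
  have hM1 : M 1 = 1 := by simp only [M, map_one]; exact LinearMap.toMatrix_one b
  have hchar : ∀ h, ρ.character h = (M h).trace := fun h =>
    LinearMap.trace_eq_matrix_trace ℂ b (ρ h)
  let H := ∑ h : Γ, (M h).conjTranspose * M h
  have hH : H.PosDef := by
    have : H = (M 1).conjTranspose * M 1 +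
        ∑ h ∈ Finset.univ.erase (1 : Γ), (M h).conjTranspose * M h :=
      (Finset.add_sum_erase _ _ (Finset.mem_univ _)).symm
    rw [this, hM1]
    refine Matrix.PosDef.add_posSemidef (by simpa using Matrix.PosDef.one) ?_
    exact Matrix.posSemidef_sum _ fun h _ => Matrix.posSemidef_conjTranspose_mul_self _
  have hinv : (M g).conjTranspose * H * M g = H := by
    simp only [H, Finset.mul_sum, Finset.sum_mul]
    refine Fintype.sum_bijective (· * g) (Group.mulRight_bijective g) _ _ fun h ↦ ?_
    rw [hM, Matrix.conjTranspose_mul]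
    simp only [Matrix.mul_assoc]
  have hgg : M g * M g⁻¹ = 1 := by rw [← hM, mul_inv_cancel, hM1]
  have h1 : (M g).conjTranspose * H = H * M g⁻¹ := by
    calc (M g).conjTranspose * H = (M g).conjTranspose * H * (M g * M g⁻¹) := by
          rw [hgg, Matrix.mul_one]
      _ = ((M g).conjTranspose * H * M g) * M g⁻¹ := by simp only [Matrix.mul_assoc]
      _ = _ := by rw [hinv]
  have hdet : IsUnit H.det := (Matrix.isUnit_iff_isUnit_det _).1 hH.isUnit
  have h2 : (M g).conjTranspose = H * M g⁻¹ * H⁻¹ := by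
    rw [← h1, Matrix.mul_assoc, Matrix.mul_nonsing_inv _ hdet, Matrix.mul_one]
  rw [hchar, hchar]
  change star _ = _
  rw [← Matrix.trace_conjTranspose, h2, Matrix.trace_mul_comm, ← Matrix.mul_assoc,
    Matrix.nonsing_inv_mul _ hdet, Matrix.one_mul]

theorem rep_char_span {Γ : Type} [Group Γ] [Fintype Γ]
    (n : ℕ) (r : Fin n → FDRep ℂ Γ)
    (hcomplete : ∀ V : FDRep ℂ Γ, Simple V → ∃ i, Nonempty (V ≅ r i)) (d : ℕ) :
    ∀ (V : Type) [AddCommGroup V] [Module ℂ V] [FiniteDimensional ℂ V]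
      (ρ : Representation ℂ Γ V), Module.finrank ℂ V = d →
      ∃ a : Fin n → ℂ, ∀ g, ρ.character g = ∑ i, a i * (r i).character g := by
  classical
  induction d using Nat.strong_induction_on with
  | _ d ih =>
  intro V _ _ _ ρ hd
  have : Invertible (Nat.card Γ : ℂ) := invertibleOfNonzero (NeZero.ne (Nat.card Γ : ℂ))
  by_cases hsub : Subsingleton V
  · refine ⟨0, fun g => ?_⟩
    have : ρ g = 0 := Subsingleton.elim _ _
    simp [Representation.character, this]
  by_cases hirr : ρ.IsIrreducible
  · have hs : Simple (FDRep.of ρ) := by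
      rw [FDRep.simple_iff_char_is_norm_one]
      have h := Representation.char_orthonormal ρ ρ
      rw [if_pos ⟨Representation.Equiv.refl ρ⟩, inv_mul_eq_one₀ (NeZero.ne _)] at h
      exact h.symm
    obtain ⟨i, ⟨e⟩⟩ := hcomplete _ hs
    refine ⟨Pi.single i 1, fun g => ?_⟩
    have h := congrFun (FDRep.char_iso e) g
    simp only [Pi.single_apply, ite_mul, one_mul, zero_mul, Finset.sum_ite_eq',
      Finset.mem_univ, if_true]
    exact h
  · have hnt : Nontrivial V := not_subsingleton_iff_nontrivial.1 hsub
    have hnt' : Nontrivial (Subrepresentation ρ) := by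
      refine ⟨⊥, ⊤, fun h => ?_⟩
      exact bot_ne_top (α := Submodule ℂ V) (congrArg Subrepresentation.toSubmodule h)
    obtain ⟨p, hp0, hp1⟩ : ∃ p : Subrepresentation ρ, p ≠ ⊥ ∧ p ≠ ⊤ := by
      by_contra! hcon
      exact hirr ⟨fun p => or_iff_not_imp_left.2 (hcon p)⟩
    obtain ⟨q, hpq⟩ := exists_isCompl p
    have hc : IsCompl p.toSubmodule q.toSubmodule := by
      refine IsCompl.of_eq ?_ ?_
      · exact congrArg Subrepresentation.toSubmodule hpq.inf_eq_bot
      · exact congrArg Subrepresentation.toSubmodule hpq.sup_eq_top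
    have hadd := Submodule.finrank_add_eq_of_isCompl hc
    have hp0' : p.toSubmodule ≠ ⊥ := fun h => hp0 (Subrepresentation.toSubmodule_injective h)
    have hp1' : p.toSubmodule ≠ ⊤ := fun h => hp1 (Subrepresentation.toSubmodule_injective h)
    have hlt := Submodule.finrank_lt hp1'
    have hpos : 0 < Module.finrank ℂ p.toSubmodule :=
      Nat.pos_of_ne_zero fun h => hp0' (Submodule.finrank_eq_zero.1 h)
    obtain ⟨a, ha⟩ := ih _ (by omega) _ p.toRepresentation rfl
    obtain ⟨b, hb⟩ := ih _ (by omega) _ q.toRepresentation rfl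
    refine ⟨a + b, fun g => ?_⟩
    have htr : ρ.character g = p.toRepresentation.character g +
        q.toRepresentation.character g := by
      let N : Bool → Submodule ℂ V := fun t => cond t p.toSubmodule q.toSubmodule
      have hN : DirectSum.IsInternal N := by
        rw [DirectSum.isInternal_submodule_iff_isCompl N (i := true) (j := false) (by simp)
          (by ext t; cases t <;> simp)]
        exact hc
      have hf : ∀ t, Set.MapsTo (ρ g) (N t) (N t) := by
        intro t
        cases t
        · exact fun v hv => q.apply_mem_toSubmodule g hv
        · exact fun v hv => p.apply_mem_toSubmodule g hv
      have h := LinearMap.trace_eq_sum_trace_restrict hN hf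
      rw [Fintype.sum_bool] at h
      exact h
    rw [htr, ha, hb, ← Finset.sum_add_distrib]
    simp [add_mul]

/-- Let `Γ` be a finite group, `R` a representation with real-valued character, and `m`
the McKay matrix `m_{ij} = ⟨χ_R χ_i, χ_j⟩` with respect to a complete repetition-free
list `r` of the irreducible representations.  Then for every group element `g`, the
vector `v_g` with components `v_g(i) = χ_i(g)` is an eigenvector of the transpose of `m`
with eigenvalue `χ_R(g)`:  `∑_i m_{ij} χ_i(g) = χ_R(g) χ_j(g)`. -/
theorem mckay_transpose_eigenvector (Γ : Type) [Group Γ] [Fintype Γ]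
    (R : FDRep ℂ Γ) (hR : ∀ g : Γ, conj (R.character g) = R.character g)
    (n : ℕ) (r : Fin n → FDRep ℂ Γ)
    (hsimple : ∀ i, Simple (r i))
    (hinj : ∀ i j, Nonempty (r i ≅ r j) → i = j)
    (hcomplete : ∀ V : FDRep ℂ Γ, Simple V → ∃ i, Nonempty (V ≅ r i)) :
    ∀ (g : Γ) (j : Fin n),
      ∑ i, mckayEntry Γ R (r i) (r j) * (r i).character g =
        R.character g * (r j).character g := by
  classical
  intro g j
  have : Invertible (Nat.card Γ : ℂ) := invertibleOfNonzero (NeZero.ne (Nat.card Γ : ℂ))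
  have hT : ∀ h, (Representation.tprod R.ρ (r j).ρ).character h =
      R.character h * (r j).character h := fun h =>
    congrFun (Representation.char_tensor R.ρ (r j).ρ) h
  obtain ⟨a, ha⟩ := rep_char_span n r hcomplete _ _ (Representation.tprod R.ρ (r j).ρ) rfl
  simp only [hT] at ha
  rw [ha]
  refine Finset.sum_congr rfl fun i _ => ?_
  congr 1
  have hconj : ∀ (V : FDRep ℂ Γ) (h : Γ), conj (V.character h) = V.character h⁻¹ :=
    fun V h => rep_char_conj V.ρ h
  have horth : ∀ k, (Nat.card Γ : ℂ)⁻¹ * ∑ h : Γ, (r k).character h * (r i).character h⁻¹ =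
      if k = i then 1 else 0 := by
    intro k
    have := hsimple k
    have := hsimple i
    rw [FDRep.char_orthonormal (r k) (r i)]
    refine if_congr ⟨hinj k i, ?_⟩ rfl rfl
    rintro rfl
    exact ⟨Iso.refl _⟩
  have h1 : mckayEntry Γ R (r i) (r j) = (Nat.card Γ : ℂ)⁻¹ *
      ∑ h : Γ, (R.character h * (r j).character h) * (r i).character h⁻¹ := by
    rw [mckayEntry, Fintype.card_eq_nat_card]
    congr 1
    refine Fintype.sum_equiv (Equiv.inv Γ) _ _ fun h => ?_
    simp only [Equiv.inv_apply, inv_inv]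
    rw [hconj, ← hconj R h, hR]
    ring
  rw [h1]
  simp only [ha, Finset.sum_mul]
  rw [Finset.sum_comm, Finset.mul_sum]
  have h2 : ∀ k, (Nat.card Γ : ℂ)⁻¹ * ∑ h : Γ, a k * (r k).character h * (r i).character h⁻¹
      = a k * if k = i then 1 else 0 := by
    intro k
    rw [← horth k]
    simp only [mul_assoc, ← Finset.mul_sum]
    ring
  rw [Finset.sum_congr rfl fun k _ => h2 k]
  simp
end
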